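/- Suppose the decision-theoretic kernel p(W_V | F_A) obeys distributional consistency. Let B and C be disjoint subsets of A (C possibly empty), and let Y, W be disjoint subsets of V∖B. Then for all y ∈ 𝔛_Y, b ∈ 𝔛_B, c ∈ 𝔛_C, w ∈ 𝔛_W such that p(W_B = b, W_W = w | F_B = ∅, F_C = c) > 0: p(W_Y = y | W_B = b, W_W = w, F_B = b, F_C = c) = p(W_Y = y | W_B = b, W_W = w, F_B = ∅, F_C = c); in particular the conditioning event under the regime F_B = b also has positive probability. -/

import Mathlib

open Finset

namespace CausalPaper

variable {V : Type*} [Fintype V] [DecidableEq V]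
variable {𝔛 : V → Type*} [∀ i, Fintype (𝔛 i)]

/-- Probability of the event `E` under the distribution `q` on joint assignments. -/
noncomputable def pr (q : (∀ i, 𝔛 i) → ℝ) (E : (∀ i, 𝔛 i) → Prop) : ℝ :=
  ∑ v : (∀ i, 𝔛 i), Set.indicator (setOf E) q v

/-- Conditional probability of `E` given `F` under `q`. -/
noncomputable def cpr (q : (∀ i, 𝔛 i) → ℝ) (E F : (∀ i, 𝔛 i) → Prop) : ℝ :=
  pr q (fun v => E v ∧ F v) / pr q F

/-- `q` is a probability distribution on joint assignments. -/
def IsProb (q : (∀ i, 𝔛 i) → ℝ) : Prop :=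
  (∀ v, 0 ≤ q v) ∧ (∑ v : (∀ i, 𝔛 i), q v) = 1

/-- `v` agrees with `s` on the coordinates in `S`. -/
def agree (S : Finset V) (s v : ∀ i, 𝔛 i) : Prop :=
  ∀ i ∈ S, v i = s i

/-- The intervention/regime that sets the variables in `B` according to `b`
(and is idle elsewhere). -/
def setOn (B : Finset V) (b : ∀ i, 𝔛 i) : ∀ i, Option (𝔛 i) :=
  fun i => if i ∈ B then some (b i) else none

/-- The intervention/regime that sets `B` according to `b` and `C` according to `c`. -/
def setOn₂ (B : Finset V) (b : ∀ i, 𝔛 i) (C : Finset V) (c : ∀ i, 𝔛 i) :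
    ∀ i, Option (𝔛 i) :=
  fun i => if i ∈ B then some (b i) else if i ∈ C then some (c i) else none

/-- The support of the partial intervention/regime `f` is contained in `A`. -/
def suppIn (f : ∀ i, Option (𝔛 i)) (A : Finset V) : Prop :=
  ∀ i, f i ≠ none → i ∈ A

/-- Distributional consistency: for `i ∈ A`, `C ⊆ A \ {i}`, the probability of the
event `{X_{V∖{i}} = y, X_i = b}` is the same whether or not `i` is additionally
intervened on and set to `b`. -/
def DistConsistent (A : Finset V) (P : (∀ i, Option (𝔛 i)) → (∀ i, 𝔛 i) → ℝ) : Prop :=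
  ∀ i ∈ A, ∀ C : Finset V, C ⊆ A \ {i} →
    ∀ (y : ∀ j, 𝔛 j) (b : 𝔛 i) (c : ∀ j, 𝔛 j),
      pr (P (Function.update (setOn C c) i (some b)))
          (fun v => agree (univ \ {i}) y v ∧ v i = b)
        = pr (P (setOn C c)) (fun v => agree (univ \ {i}) y v ∧ v i = b)

theorem pr_agree_compl_singleton (q : (∀ i, 𝔛 i) → ℝ) (i : V) (v : ∀ j, 𝔛 j) :
    pr q (fun u => agree (univ \ {i}) v u ∧ u i = v i) = q v := by
  have hset : setOf (fun u : ∀ j, 𝔛 j => agree (univ \ {i}) v u ∧ u i = v i) = {v} := by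
    ext u
    simp only [Set.mem_singleton_iff, agree]
    constructor
    · rintro ⟨hne, hi⟩
      funext j
      by_cases hj : j = i
      · subst hj
        exact hi
      · exact hne j (by simp [hj])
    · rintro rfl
      exact ⟨fun _ _ => rfl, rfl⟩
  rw [pr, hset, Finset.sum_eq_single v]
  · simp
  · intro u _ hu
    simp [hu]
  · simp

theorem setOn₂_eq_setOn_union (B C : Finset V) (b c : ∀ j, 𝔛 j) :
    setOn₂ B b C c = setOn (B ∪ C) (fun j => if j ∈ B then b j else c j) := by
  funext j
  by_cases hB : j ∈ B <;> by_cases hC : j ∈ C <;> simp [setOn₂, setOn, hB, hC]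

theorem setOn₂_insert (i : V) (B C : Finset V) (b c : ∀ j, 𝔛 j) :
    setOn₂ (insert i B) b C c = Function.update (setOn₂ B b C c) i (some (b i)) := by
  funext j
  by_cases hj : j = i
  · subst hj
    simp [setOn₂]
  · simp [setOn₂, hj]

/-- Under distributional consistency, additionally setting `B` to `b` does not change the
probability of any joint assignment that agrees with `b` on `B`. -/
theorem DistConsistent.apply_setOn₂ {A : Finset V}
    {P : (∀ i, Option (𝔛 i)) → (∀ i, 𝔛 i) → ℝ} (hDC : DistConsistent A P)
    {B C : Finset V} (hBA : B ⊆ A) (hCA : C ⊆ A) (hBC : Disjoint B C)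
    (b c : ∀ j, 𝔛 j) {v : ∀ j, 𝔛 j} (hv : agree B b v) :
    P (setOn₂ B b C c) v = P (setOn C c) v := by
  induction B using Finset.induction_on with
  | empty => simp [setOn₂_eq_setOn_union]
  | insert i B hi ih =>
    rw [Finset.insert_subset_iff] at hBA
    rw [Finset.disjoint_insert_left] at hBC
    rw [← ih hBA.2 hBC.2 fun j hj => hv j (Finset.mem_insert_of_mem hj),
      setOn₂_insert, setOn₂_eq_setOn_union, ← hv i (Finset.mem_insert_self i B)]
    have hsub : B ∪ C ⊆ A \ {i} := by
      intro j hj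
      rw [Finset.mem_sdiff, Finset.mem_singleton]
      refine ⟨Finset.union_subset hBA.2 hCA hj, ?_⟩
      rintro rfl
      exact (Finset.mem_union.mp hj).elim hi hBC.1
    simpa only [pr_agree_compl_singleton] using
      hDC i hBA.1 (B ∪ C) hsub v (v i) (fun j => if j ∈ B then b j else c j)

theorem pr_congr {q r : (∀ i, 𝔛 i) → ℝ} {E : (∀ i, 𝔛 i) → Prop}
    (h : ∀ v, E v → q v = r v) : pr q E = pr r E := by
  refine Finset.sum_congr rfl fun v _ => ?_
  by_cases hv : v ∈ setOf E
  · rw [Set.indicator_of_mem hv, Set.indicator_of_mem hv, h v hv]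
  · rw [Set.indicator_of_notMem hv, Set.indicator_of_notMem hv]

/-- Decision-theoretic conditional consistency: conditionals given `W_B = b, W_W = w`
agree under the regimes `F_B = b, F_C = c` and `F_B = ∅, F_C = c`. -/
theorem stmt10_kernel_cond_consistency
    (A B C : Finset V) (hBA : B ⊆ A) (hCA : C ⊆ A) (hBC : Disjoint B C)
    (Y W : Finset V) (hYW : Disjoint Y W)
    (hY : Y ⊆ univ \ B) (hW : W ⊆ univ \ B)
    (P : (∀ i, Option (𝔛 i)) → (∀ i, 𝔛 i) → ℝ)
    (hP : ∀ f, suppIn f A → IsProb (P f))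
    (hDC : DistConsistent A P)
    (y b c w : ∀ j, 𝔛 j)
    (hpos : 0 < pr (P (setOn C c)) (fun v => agree B b v ∧ agree W w v)) :
    0 < pr (P (setOn₂ B b C c)) (fun v => agree B b v ∧ agree W w v) ∧
    cpr (P (setOn₂ B b C c)) (agree Y y) (fun v => agree B b v ∧ agree W w v)
      = cpr (P (setOn C c)) (agree Y y) (fun v => agree B b v ∧ agree W w v) := by
  have heq : ∀ v, agree B b v → P (setOn₂ B b C c) v = P (setOn C c) v :=
    fun v hv => hDC.apply_setOn₂ hBA hCA hBC b c hv
  have hden : pr (P (setOn₂ B b C c)) (fun v => agree B b v ∧ agree W w v)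
      = pr (P (setOn C c)) (fun v => agree B b v ∧ agree W w v) :=
    pr_congr fun v hv => heq v hv.1
  refine ⟨hden ▸ hpos, ?_⟩
  rw [cpr, cpr, hden, pr_congr fun v hv => heq v hv.2.1]

end CausalPaper
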